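/- Let a, b be complex numbers such that b + m ≠ 0, b/2 + m ≠ 0 and (b+1)/2 + m ≠ 0 for every natural number m. Then for every natural number k, ∑_{j=0}^{2k} [(a)_j / ((b)_j · j!)] · [(a)_{2k−j} (−1)^{2k−j} / ((b)_{2k−j} · (2k−j)!)] = (b−a)_k (a)_k / ((b)_k (b/2)_k ((b+1)/2)_k · k! · 4^k). (This expresses the identity ₁F₁(a;b;x) · ₁F₁(a;b;−x) = ₂F₃(b−a, a; b, b/2, (b+1)/2; x²/4) at the level of the even power-series coefficients.) -/

import Mathlib

/-- Rising factorial (Pochhammer symbol) `(z)_n` over the complex numbers. -/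
noncomputable def poch (z : ℂ) (n : ℕ) : ℂ := (ascPochhammer ℂ n).eval z

theorem poch_succ (z : ℂ) (n : ℕ) : poch z (n + 1) = poch z n * (z + n) :=
  ascPochhammer_succ_eval n z

theorem poch_ne_zero {z : ℂ} (hz : ∀ m : ℕ, z + (m : ℂ) ≠ 0) (n : ℕ) : poch z n ≠ 0 := by
  induction n with
  | zero => simp [poch]
  | succ n ih => rw [poch_succ]; exact mul_ne_zero ih (hz n)

/-- The coefficient of `x ^ j` in the confluent hypergeometric series `₁F₁(a; b; x)`. -/
noncomputable def kummerCoeff (a b : ℂ) (j : ℕ) : ℂ := poch a j / (poch b j * (j.factorial : ℂ))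

theorem kummerCoeff_zero (a b : ℂ) : kummerCoeff a b 0 = 1 := by
  simp [kummerCoeff, poch]

theorem kummerCoeff_succ (a : ℂ) {b : ℂ} (hb : ∀ m : ℕ, b + (m : ℂ) ≠ 0) (j : ℕ) :
    kummerCoeff a b (j + 1) = (a + j) * kummerCoeff a b j / ((b + j) * (j + 1)) := by
  have h₁ := poch_ne_zero hb j
  have h₂ := hb j
  have h₃ : (j.factorial : ℂ) ≠ 0 := mod_cast j.factorial_ne_zero
  have h₄ : (j : ℂ) + 1 ≠ 0 := Nat.cast_add_one_ne_zero j
  simp only [kummerCoeff, poch_succ, Nat.factorial_succ]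
  push_cast
  field_simp

/-- The polynomial factor of the Zeilberger certificate for the even coefficients of
`₁F₁(a; b; x) * ₁F₁(a; b; -x)`. -/
noncomputable def certPoly (a b k j : ℂ) : ℂ :=
  (-2 * k + 3 * k * j - k * j ^ 2 - 8 * k ^ 2 + 6 * k ^ 2 * j - 8 * k ^ 3 - b * k + 2 * b * k * j
    - 4 * b * k ^ 2 + b ^ 2 - 2 * a + 3 * a * j - a * j ^ 2 - 10 * a * k + 6 * a * k * j
    - 10 * a * k ^ 2 - 4 * a * b + 2 * a * b * j - 7 * a * b * k - a * b ^ 2) / 2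

/-- The Zeilberger certificate at index `j`, where `m` stands for `2 * k + 1 - j`. -/
noncomputable def cert (a b k : ℂ) (j m : ℕ) : ℂ :=
  (-1) ^ j * (j * (b + j - 1)) * kummerCoeff a b j * kummerCoeff a b m * certPoly a b k j /
    ((b + m) * (m + 1))

theorem cert_sub_cert (a : ℂ) {b : ℂ} (hb : ∀ m : ℕ, b + (m : ℂ) ≠ 0) (k : ℂ) (j m : ℕ)
    (hk : 2 * k = j + m) :
    cert a b k (j + 1) m - cert a b k j (m + 1) =
      (k + 1) * (b + k) * (b + 2 * k) * (b + 2 * k + 1) *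
          ((-1) ^ j * kummerCoeff a b j * kummerCoeff a b (m + 2)) -
        (b - a + k) * (a + k) * ((-1) ^ j * kummerCoeff a b j * kummerCoeff a b m) := by
  have h₁ := hb j
  have h₂ := hb m
  have h₃ : b + ((m : ℂ) + 1) ≠ 0 := mod_cast hb (m + 1)
  have h₄ : (j : ℂ) + 1 ≠ 0 := Nat.cast_add_one_ne_zero j
  have h₅ : (m : ℂ) + 1 ≠ 0 := Nat.cast_add_one_ne_zero m
  have h₆ : (m : ℂ) + 1 + 1 ≠ 0 := mod_cast Nat.cast_add_one_ne_zero (R := ℂ) (m + 1)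
  obtain rfl : k = (j + m) / 2 := by linear_combination hk / 2
  simp only [cert, certPoly, kummerCoeff_succ a hb, pow_succ]
  push_cast
  field_simp
  ring

theorem sum_range_eq_cert (a : ℂ) {b : ℂ} (hb : ∀ m : ℕ, b + (m : ℂ) ≠ 0) (k i : ℕ)
    (hi : i ≤ 2 * k + 1) :
    ∑ j ∈ Finset.range i,
      ((k + 1) * (b + k) * (b + 2 * k) * (b + 2 * k + 1) *
          ((-1) ^ j * kummerCoeff a b j * kummerCoeff a b (2 * (k + 1) - j)) -
        (b - a + k) * (a + k) * ((-1) ^ j * kummerCoeff a b j * kummerCoeff a b (2 * k - j))) =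
      cert a b k i (2 * k + 1 - i) := by
  induction i with
  | zero => simp [cert]
  | succ i ih =>
    obtain ⟨m, hm⟩ := Nat.exists_eq_add_of_le (show i ≤ 2 * k by omega)
    have e₁ : 2 * (k + 1) - i = m + 2 := by omega
    have e₂ : 2 * k - i = m := by omega
    have e₃ : 2 * k + 1 - i = m + 1 := by omega
    have e₄ : 2 * k + 1 - (i + 1) = m := by omega
    rw [Finset.sum_range_succ, ih (by omega), e₁, e₂, e₃, e₄,
      ← cert_sub_cert a hb k i m (mod_cast hm)]
    ring

/-- The coefficient of `x ^ (2 * k)` in `₁F₁(a; b; x) * ₁F₁(a; b; -x)`. -/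
noncomputable def kummerProdCoeff (a b : ℂ) (k : ℕ) : ℂ :=
  ∑ j ∈ Finset.range (2 * k + 1), (-1) ^ j * kummerCoeff a b j * kummerCoeff a b (2 * k - j)

theorem kummerProdCoeff_succ (a : ℂ) {b : ℂ} (hb : ∀ m : ℕ, b + (m : ℂ) ≠ 0) (k : ℕ) :
    (k + 1) * (b + k) * (b + 2 * k) * (b + 2 * k + 1) * kummerProdCoeff a b (k + 1) =
      (b - a + k) * (a + k) * kummerProdCoeff a b k := by
  have h := sum_range_eq_cert a hb k (2 * k + 1) le_rfl
  rw [Finset.sum_sub_distrib, ← Finset.mul_sum, ← Finset.mul_sum, sub_eq_iff_eq_add] at h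
  have e : 2 * (k + 1) - (2 * k + 1) = 1 := by omega
  have hs : (-1 : ℂ) ^ (2 * k) = 1 := by simp
  have boundary : (k + 1) * (b + k) * (b + 2 * k) * (b + 2 * k + 1) *
      ((-1) ^ (2 * k + 1) * kummerCoeff a b (2 * k + 1) * kummerCoeff a b 1 +
        (-1) ^ (2 * k + 2) * kummerCoeff a b (2 * k + 2)) + cert a b k (2 * k + 1) 0 = 0 := by
    have h₀ : b ≠ 0 := by simpa using hb 0
    have h₂ : b + (k : ℂ) * 2 + 1 ≠ 0 := by
      rw [add_assoc, mul_comm]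
      exact mod_cast hb (2 * k + 1)
    have h₄ : (k : ℂ) * 2 + 1 + 1 ≠ 0 := mod_cast Nat.cast_add_one_ne_zero (R := ℂ) (k * 2 + 1)
    have hc : kummerCoeff a b 1 = a / b := by
      simpa [kummerCoeff_zero] using kummerCoeff_succ a hb 0
    simp only [cert, certPoly, hc, kummerCoeff_zero, kummerCoeff_succ a hb (2 * k + 1),
      pow_succ _ (2 * k), pow_succ _ (2 * k + 1), hs]
    push_cast
    rw [add_zero, zero_add, ← add_assoc b]
    field_simp
    ring
  rw [kummerProdCoeff, kummerProdCoeff, show 2 * (k + 1) + 1 = 2 * k + 1 + 1 + 1 by ring,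
    Finset.sum_range_succ, Finset.sum_range_succ, e,
    show 2 * (k + 1) - (2 * k + 1 + 1) = 0 by omega, kummerCoeff_zero]
  rw [Nat.sub_self] at h
  linear_combination h + boundary

theorem stmt_7 (a b : ℂ)
    (hb : ∀ m : ℕ, b + (m : ℂ) ≠ 0)
    (hb2 : ∀ m : ℕ, b / 2 + (m : ℂ) ≠ 0)
    (hb3 : ∀ m : ℕ, (b + 1) / 2 + (m : ℂ) ≠ 0) (k : ℕ) :
    ∑ j ∈ Finset.range (2 * k + 1),
      (poch a j / (poch b j * (j.factorial : ℂ))) *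
        (poch a (2 * k - j) * (-1 : ℂ) ^ (2 * k - j) /
          (poch b (2 * k - j) * ((2 * k - j).factorial : ℂ)))
      = poch (b - a) k * poch a k /
          (poch b k * poch (b / 2) k * poch ((b + 1) / 2) k * (k.factorial : ℂ) * 4 ^ k) := by
  have hsum : ∀ k, ∑ j ∈ Finset.range (2 * k + 1),
      (poch a j / (poch b j * (j.factorial : ℂ))) *
        (poch a (2 * k - j) * (-1 : ℂ) ^ (2 * k - j) /
          (poch b (2 * k - j) * ((2 * k - j).factorial : ℂ))) = kummerProdCoeff a b k := by
    intro k
    refine Finset.sum_congr rfl fun j hj => ?_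
    have hj' : j ≤ 2 * k := by simpa [Nat.lt_succ_iff] using hj
    have hs : (-1 : ℂ) ^ (2 * k - j) = (-1) ^ j := by
      rw [neg_one_pow_congr]
      simp [Nat.even_sub hj']
    rw [hs, kummerCoeff, kummerCoeff]
    ring
  rw [hsum]
  induction k with
  | zero => simp [kummerProdCoeff, kummerCoeff_zero, poch]
  | succ k ih =>
    have h₁ : (k : ℂ) + 1 ≠ 0 := Nat.cast_add_one_ne_zero k
    have h₂ := hb k
    have h₃ : b + 2 * (k : ℂ) ≠ 0 := mod_cast hb (2 * k)
    have h₄ : b + 2 * (k : ℂ) + 1 ≠ 0 := by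
      have := hb (2 * k + 1)
      push_cast at this
      rwa [← add_assoc] at this
    have h₅ := poch_ne_zero hb k
    have h₆ := poch_ne_zero hb2 k
    have h₇ := poch_ne_zero hb3 k
    have h₈ : (k.factorial : ℂ) ≠ 0 := mod_cast k.factorial_ne_zero
    have hp : ((k : ℂ) + 1) * (b + k) * (b + 2 * k) * (b + 2 * k + 1) ≠ 0 := by
      simp [h₁, h₂, h₃, h₄]
    have e₁ : b / 2 + (k : ℂ) = (b + 2 * k) / 2 := by ring
    have e₂ : (b + 1) / 2 + (k : ℂ) = (b + 2 * k + 1) / 2 := by ring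
    apply mul_left_cancel₀ hp
    rw [kummerProdCoeff_succ a hb, ih]
    simp only [poch_succ, Nat.factorial_succ, pow_succ, e₁, e₂]
    push_cast
    generalize b + 2 * (k : ℂ) = d at *
    field_simp
    norm_num
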